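/- arXiv:2005.14346 — 2 statements merged into one kernel-verified Lean document; each statement's English description precedes it below -/
import Mathlib

section
/- Let M > 0 and suppose the real numbers g, s, β satisfy 0 ≤ g ≤ 1, 0 ≤ s ≤ M²g, and s·g ≥ β². Then −Mg ≤ β ≤ Mg. Consequently, every point feasible for the continuous relaxation of the MISOCP constraints is feasible for the continuous relaxation of the big-M MIQP constraints (R(MISOCP) ⊆ R(MIQP)). -/
/-- the continuous MISOCP constraints imply the big-M constraints:
    if 0 ≤ g ≤ 1, 0 ≤ s ≤ M²g and s·g ≥ β², then −Mg ≤ β ≤ Mg. -/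
theorem misocp_relaxation_subset_bigM (M g s β : ℝ) (hM : 0 < M)
    (hg0 : 0 ≤ g) (hg1 : g ≤ 1) (hs0 : 0 ≤ s) (hs : s ≤ M ^ 2 * g)
    (hcone : β ^ 2 ≤ s * g) :
    -(M * g) ≤ β ∧ β ≤ M * g := by
  have h : β ^ 2 ≤ (M * g) ^ 2 := by
    have h1 : s * g ≤ M ^ 2 * g * g := mul_le_mul_of_nonneg_right hs hg0
    calc β ^ 2 ≤ M ^ 2 * g * g := hcone.trans h1
      _ = (M * g) ^ 2 := by ring
  exact abs_le.mp (abs_le_of_sq_le_sq h (mul_nonneg hM.le hg0))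
end

section
/- Let X ∈ ℝ^{n×m}, let B⁰, B⋆, B̂ ∈ ℝ^{m×m}, set E := X − XB⁰ and ℓ(B) := ‖X − XB‖_F². Suppose κ > 0 is such that XᵀX − κ·I is positive semidefinite, and set c₁ = 1/κ. Then ‖B̂ − B⋆‖_F² ≤ c₁·|ℓ(B̂) − ℓ(B⋆)| + 2c₁·( ‖XᵀX‖₂·‖B⋆ − B⁰‖_F + ‖XᵀE‖_F )·‖B̂ − B⋆‖_F, where ‖XᵀX‖₂ denotes the ℓ²→ℓ² operator (spectral) norm of XᵀX. -/
open Matrix BigOperators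

/-- Squared Frobenius norm of a matrix. -/
def frobSq {n m : ℕ} (A : Matrix (Fin n) (Fin m) ℝ) : ℝ :=
  ∑ i, ∑ j, (A i j) ^ 2

/-- Frobenius norm of a matrix. -/
noncomputable def frobNorm {n m : ℕ} (A : Matrix (Fin n) (Fin m) ℝ) : ℝ :=
  Real.sqrt (∑ i, ∑ j, (A i j) ^ 2)

/-- Spectral (ℓ²→ℓ²) operator norm of a square matrix. -/
noncomputable def specNorm {m : ℕ} (A : Matrix (Fin m) (Fin m) ℝ) : ℝ :=
  ‖Matrix.toEuclideanCLM (𝕜 := ℝ) A‖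

lemma frobSq_eq_trace {n m : ℕ} (A : Matrix (Fin n) (Fin m) ℝ) :
    frobSq A = (Aᵀ * A).trace := by
  simp only [frobSq, Matrix.trace, Matrix.diag, Matrix.mul_apply, Matrix.transpose_apply, ← sq]
  exact Finset.sum_comm

lemma trace_le_frob {n m : ℕ} (A B : Matrix (Fin n) (Fin m) ℝ) :
    (Aᵀ * B).trace ≤ frobNorm A * frobNorm B := by
  have h := Real.sum_mul_le_sqrt_mul_sqrt (Finset.univ : Finset (Fin n × Fin m))
    (fun p => A p.1 p.2) (fun p => B p.1 p.2)
  simp only [Fintype.sum_prod_type] at h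
  simp only [frobNorm, Matrix.trace, Matrix.diag, Matrix.mul_apply, Matrix.transpose_apply]
  rw [Finset.sum_comm]
  exact h

lemma frobNorm_neg {n m : ℕ} (A : Matrix (Fin n) (Fin m) ℝ) :
    frobNorm (-A) = frobNorm A := by
  simp [frobNorm]

lemma frobNorm_mul_le {m : ℕ} (M S : Matrix (Fin m) (Fin m) ℝ) :
    frobNorm (M * S) ≤ specNorm M * frobNorm S := by
  have hs : 0 ≤ specNorm M := norm_nonneg _
  unfold frobNorm
  rw [← Real.sqrt_sq hs, ← Real.sqrt_mul (sq_nonneg _)]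
  apply Real.sqrt_le_sqrt
  rw [Finset.sum_comm, Finset.sum_comm (f := fun i j => S i j ^ 2), Finset.mul_sum]
  apply Finset.sum_le_sum
  intro j _
  have h := (Matrix.toEuclideanCLM (𝕜 := ℝ) M).le_opNorm (WithLp.toLp 2 (fun i => S i j))
  have h2 := pow_le_pow_left₀ (norm_nonneg _) h 2
  rw [mul_pow, EuclideanSpace.real_norm_sq_eq, EuclideanSpace.real_norm_sq_eq] at h2
  simpa [Matrix.toEuclideanCLM_toLp, Matrix.mulVec, dotProduct, Matrix.mul_apply, specNorm] using h2

lemma kappa_frobSq_le {n m : ℕ} (X : Matrix (Fin n) (Fin m) ℝ) (D : Matrix (Fin m) (Fin m) ℝ)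
    (κ : ℝ)
    (hpsd : ∀ v : Fin m → ℝ,
      0 ≤ v ⬝ᵥ ((Xᵀ * X - κ • (1 : Matrix (Fin m) (Fin m) ℝ)) *ᵥ v)) :
    κ * frobSq D ≤ frobSq (X * D) := by
  have h : 0 ≤ (Dᵀ * ((Xᵀ * X - κ • (1 : Matrix (Fin m) (Fin m) ℝ)) * D)).trace := by
    apply Finset.sum_nonneg
    intro j _
    exact hpsd (fun i => D i j)
  rw [frobSq_eq_trace, frobSq_eq_trace, Matrix.transpose_mul]
  simp only [Matrix.sub_mul, Matrix.mul_sub, Matrix.trace_sub, Matrix.smul_mul, Matrix.one_mul,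
    Matrix.mul_smul, Matrix.trace_smul, smul_eq_mul, Matrix.mul_assoc] at h ⊢
  linarith

/-- the core deterministic estimate of the early-stopping proof:
    if XᵀX − κI ⪰ 0 with κ > 0 and c₁ = 1/κ, then
    ‖B̂ − B⋆‖_F² ≤ c₁|ℓ(B̂) − ℓ(B⋆)|
        + 2c₁(‖XᵀX‖₂‖B⋆ − B⁰‖_F + ‖XᵀE‖_F)‖B̂ − B⋆‖_F,
    where E = X − X B⁰ and ℓ(B) = ‖X − XB‖_F². -/
theorem early_stopping_core_estimate (n m : ℕ)
    (X : Matrix (Fin n) (Fin m) ℝ)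
    (B0 Bstar Bhat : Matrix (Fin m) (Fin m) ℝ)
    (κ : ℝ) (hκ : 0 < κ)
    (hpsd : ∀ v : Fin m → ℝ,
      0 ≤ v ⬝ᵥ ((Xᵀ * X - κ • (1 : Matrix (Fin m) (Fin m) ℝ)) *ᵥ v)) :
    frobSq (Bhat - Bstar) ≤
      (1 / κ) * |frobSq (X - X * Bhat) - frobSq (X - X * Bstar)|
        + 2 * (1 / κ) *
          (specNorm (Xᵀ * X) * frobNorm (Bstar - B0)
            + frobNorm (Xᵀ * (X - X * B0))) * frobNorm (Bhat - Bstar) := by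
  have hk := kappa_frobSq_le X (Bhat - Bstar) κ hpsd
  have h1 := trace_le_frob (Xᵀ * (X - X * B0)) (Bhat - Bstar)
  have h2 := trace_le_frob (-(Xᵀ * X * (Bstar - B0))) (Bhat - Bstar)
  have h3 := mul_le_mul_of_nonneg_right (frobNorm_mul_le (Xᵀ * X) (Bstar - B0))
    (show 0 ≤ frobNorm (Bhat - Bstar) from Real.sqrt_nonneg _)
  rw [frobNorm_neg] at h2
  have key : frobSq (X * (Bhat - Bstar)) =
      (frobSq (X - X * Bhat) - frobSq (X - X * Bstar))
      + 2 * ((Xᵀ * (X - X * B0))ᵀ * (Bhat - Bstar)).trace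
      + 2 * ((-(Xᵀ * X * (Bstar - B0)))ᵀ * (Bhat - Bstar)).trace := by
    have e1 : X - X * Bhat = (X - X * Bstar) - X * (Bhat - Bstar) := by
      rw [Matrix.mul_sub]; abel
    have e2 : (Xᵀ * (X - X * B0))ᵀ * (Bhat - Bstar)
        + (-(Xᵀ * X * (Bstar - B0)))ᵀ * (Bhat - Bstar)
        = (X - X * Bstar)ᵀ * (X * (Bhat - Bstar)) := by
      have e0 : Xᵀ * (X - X * B0) + -(Xᵀ * X * (Bstar - B0)) = Xᵀ * (X - X * Bstar) := by
        simp only [Matrix.mul_sub, Matrix.mul_assoc]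
        abel
      rw [← Matrix.add_mul, ← Matrix.transpose_add, e0, Matrix.transpose_mul,
        Matrix.transpose_transpose, Matrix.mul_assoc]
    have e3 := congrArg Matrix.trace e2
    rw [Matrix.trace_add] at e3
    rw [e1]
    generalize X - X * Bstar = R at *
    generalize X * (Bhat - Bstar) = Y at *
    have e4 : (Yᵀ * R).trace = (Rᵀ * Y).trace := by
      rw [← Matrix.trace_transpose, Matrix.transpose_mul, Matrix.transpose_transpose]
    have e5 : frobSq (R - Y) = frobSq R - 2 * (Rᵀ * Y).trace + frobSq Y := by
      simp only [frobSq_eq_trace, Matrix.transpose_sub, Matrix.sub_mul, Matrix.mul_sub,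
        Matrix.trace_sub]
      linarith
    linarith
  have habs := le_abs_self (frobSq (X - X * Bhat) - frobSq (X - X * Bstar))
  have hfin : κ * frobSq (Bhat - Bstar) ≤
      |frobSq (X - X * Bhat) - frobSq (X - X * Bstar)|
        + 2 * (specNorm (Xᵀ * X) * frobNorm (Bstar - B0)
            + frobNorm (Xᵀ * (X - X * B0))) * frobNorm (Bhat - Bstar) := by
    linarith
  have hdiv := (le_div_iff₀' hκ).mpr hfin
  refine hdiv.trans (le_of_eq ?_)
  field_simp
end
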